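/- Let σ be a distortion function, X ≠ {0} a Banach space and p ∈ [1,∞). The following are equivalent: (1) L_σ^p(P,X) with the norm ‖·‖_{σ,p} is a Hilbert space (the norm satisfies the parallelogram law); (2) X is a Hilbert space, p = 2, and σ(u) = 1 for all u ∈ (0,1). -/

import Mathlib

open MeasureTheory
open scoped ENNReal NNReal

noncomputable section

variable {Ω : Type*} [MeasurableSpace Ω]

/-- A `[0,1]`-valued random variable uniformly distributed on `[0,1]`:
`P(U ≤ u) = u` for all `u ∈ [0,1]`. -/
def IsUniformRV (P : Measure Ω) (U : Ω → ℝ) : Prop :=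
  Measurable U ∧ (∀ ω, U ω ∈ Set.Icc (0 : ℝ) 1) ∧
    ∀ u ∈ Set.Icc (0 : ℝ) 1, P {ω | U ω ≤ u} = ENNReal.ofReal u

/-- A distortion function: nondecreasing, nonnegative, left-continuous on `[0,1)`
with `∫₀¹ σ(u) du = 1`. -/
structure IsDistortion (σ : ℝ → ℝ) : Prop where
  nonneg : ∀ u ∈ Set.Ico (0 : ℝ) 1, 0 ≤ σ u
  mono : MonotoneOn σ (Set.Ico (0 : ℝ) 1)
  left_continuous : ∀ u ∈ Set.Ioo (0 : ℝ) 1,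
    Filter.Tendsto σ (nhdsWithin u (Set.Iio u)) (nhds (σ u))
  integral_one : ∫ u in Set.Ioo (0 : ℝ) 1, σ u = 1

/-- `‖Y‖_{σ,p}^p := sup over uniform U of E[σ(U)·‖Y‖^p]`. -/
def sigmaPow (P : Measure Ω) (σ : ℝ → ℝ) (p : ℝ) {X : Type*} [NormedAddCommGroup X]
    (Y : Ω → X) : ℝ≥0∞ :=
  ⨆ (U : Ω → ℝ) (_ : IsUniformRV P U),
    ∫⁻ ω, ENNReal.ofReal (σ (U ω)) * (‖Y ω‖₊ : ℝ≥0∞) ^ p ∂P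

/-- The norm `‖Y‖_{σ,p}`. -/
def sigmaNorm (P : Measure Ω) (σ : ℝ → ℝ) (p : ℝ) {X : Type*} [NormedAddCommGroup X]
    (Y : Ω → X) : ℝ≥0∞ :=
  sigmaPow P σ p Y ^ (1 / p)

/-- Membership in `L_σ^p(P,X)`: strongly measurable with finite `σ,p`-norm. -/
def MemLsigma (P : Measure Ω) (σ : ℝ → ℝ) (p : ℝ) {X : Type*} [NormedAddCommGroup X]
    (Y : Ω → X) : Prop :=
  AEStronglyMeasurable Y P ∧ sigmaPow P σ p Y < ∞

/-- The generalized inverse distribution function (quantile function)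
`F_g^{-1}(α) = inf {q : P(g ≤ q) ≥ α}`. -/
def quantileFn (P : Measure Ω) (g : Ω → ℝ) (α : ℝ) : ℝ :=
  sInf {q : ℝ | ENNReal.ofReal α ≤ P {ω | g ω ≤ q}}

/-- The tail mass `∫_c^1 σ(u) du` of a distortion function. -/
def distortionTail (σ : ℝ → ℝ) (c : ℝ) : ℝ≥0∞ :=
  ∫⁻ u in Set.Ioo c 1, ENNReal.ofReal (σ u)

lemma IsUniformRV.map_eq {P : Measure Ω} [IsProbabilityMeasure P] {U : Ω → ℝ}
    (hU : IsUniformRV P U) : P.map U = volume.restrict (Set.Ioo (0 : ℝ) 1) := by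
  obtain ⟨hm, hI, hd⟩ := hU
  have : IsProbabilityMeasure (P.map U) := Measure.isProbabilityMeasure_map hm.aemeasurable
  rw [Measure.restrict_congr_set Ioo_ae_eq_Icc]
  refine Measure.ext_of_Iic _ _ fun a => ?_
  rw [Measure.map_apply hm measurableSet_Iic, Measure.restrict_apply measurableSet_Iic]
  rcases lt_trichotomy a 0 with ha | ha | ha
  · have h1 : U ⁻¹' Set.Iic a = ∅ := by
      ext ω
      simpa using ha.trans_le (hI ω).1
    have h2 : Set.Iic a ∩ Set.Icc (0 : ℝ) 1 = ∅ := by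
      ext x
      simp only [Set.mem_inter_iff, Set.mem_Iic, Set.mem_Icc, Set.mem_empty_iff_false]
      exact ⟨fun h => by linarith [h.1, h.2.1], False.elim⟩
    simp [h1, h2]
  · subst ha
    have h2 : Set.Iic (0 : ℝ) ∩ Set.Icc (0 : ℝ) 1 = {0} := by
      ext x
      simp only [Set.mem_inter_iff, Set.mem_Iic, Set.mem_Icc, Set.mem_singleton_iff]
      exact ⟨fun h => le_antisymm h.1 h.2.1, fun h => by simp [h]⟩
    have h1 := hd 0 (by simp)
    simp only [h2, Real.volume_singleton]
    change P {ω | U ω ≤ 0} = 0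
    simpa using h1
  · rcases le_total a 1 with h1 | h1
    · have h2 : Set.Iic a ∩ Set.Icc (0 : ℝ) 1 = Set.Icc 0 a := by
        ext x
        simp only [Set.mem_inter_iff, Set.mem_Iic, Set.mem_Icc]
        exact ⟨fun h => ⟨h.2.1, h.1⟩, fun h => ⟨h.2, h.1, h.2.trans h1⟩⟩
      rw [h2, Real.volume_Icc, sub_zero]
      exact hd a ⟨ha.le, h1⟩
    · have h2 : Set.Iic a ∩ Set.Icc (0 : ℝ) 1 = Set.Icc 0 1 := by
        ext x
        simp only [Set.mem_inter_iff, Set.mem_Iic, Set.mem_Icc]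
        exact ⟨fun h => h.2, fun h => ⟨h.2.trans h1, h⟩⟩
      have h3 : U ⁻¹' Set.Iic a = Set.univ := by
        ext ω
        simpa using (hI ω).2.trans h1
      simp [h2, h3]

lemma IsUniformRV.ae_mem_Ioo {P : Measure Ω} [IsProbabilityMeasure P] {U : Ω → ℝ}
    (hU : IsUniformRV P U) : ∀ᵐ ω ∂P, U ω ∈ Set.Ioo (0 : ℝ) 1 := by
  apply ae_of_ae_map hU.1.aemeasurable
  rw [hU.map_eq]
  exact ae_restrict_mem measurableSet_Ioo

lemma IsUniformRV.measure_gt {P : Measure Ω} [IsProbabilityMeasure P] {U : Ω → ℝ}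
    (hU : IsUniformRV P U) {c : ℝ} (hc : c ∈ Set.Icc (0 : ℝ) 1) :
    P {ω | c < U ω} = ENNReal.ofReal (1 - c) := by
  have h : {ω | c < U ω} = {ω | U ω ≤ c}ᶜ := by
    ext ω
    simp
  rw [h, prob_compl_eq_one_sub (measurableSet_le hU.1 measurable_const), hU.2.2 c hc,
    ENNReal.ofReal_sub _ hc.1, ENNReal.ofReal_one]

/-- Rotating a uniform random variable by `α` modulo one gives a uniform random variable. -/
lemma IsUniformRV.rotate {P : Measure Ω} [IsProbabilityMeasure P] {U : Ω → ℝ}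
    (hU : IsUniformRV P U) {α : ℝ} (hα : α ∈ Set.Icc (0 : ℝ) 1) :
    IsUniformRV P fun ω => if U ω ≤ 1 - α then U ω + α else U ω + α - 1 := by
  have hms (c : ℝ) : MeasurableSet {ω | U ω ≤ c} := measurableSet_le hU.1 measurable_const
  refine ⟨Measurable.ite (hms _) (hU.1.add_const _) ((hU.1.add_const _).sub_const _),
    fun ω => ?_, fun u hu => ?_⟩
  · have := hU.2.1 ω
    rw [Set.mem_Icc] at this hα ⊢
    dsimp only
    split_ifs <;> constructor <;> linarith
  · rcases lt_or_ge u α with h | h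
    · have hset : {ω | (if U ω ≤ 1 - α then U ω + α else U ω + α - 1) ≤ u}
          =ᵐ[P] ({ω | 1 - α < U ω} \ {ω | u + 1 - α < U ω} : Set Ω) := by
        filter_upwards [hU.ae_mem_Ioo] with ω hω
        apply propext
        change (if U ω ≤ 1 - α then U ω + α else U ω + α - 1) ≤ u
          ↔ (1 - α < U ω ∧ ¬ (u + 1 - α < U ω))
        rw [Set.mem_Ioo] at hω
        split_ifs with h1
        · constructor
          · intro h2; linarith
          · intro h2; linarith [h2.1]
        · constructor
          · intro h2; exact ⟨by linarith, by linarith⟩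
          · intro h2; linarith [h2.2]
      rw [measure_congr hset, measure_sdiff _ (measurableSet_lt measurable_const hU.1).nullMeasurableSet
        (measure_ne_top _ _), hU.measure_gt ⟨by linarith [hα.2], by linarith [hα.1]⟩,
        hU.measure_gt ⟨by linarith [hα.2, hu.1], by linarith⟩, ← ENNReal.ofReal_sub _ (by linarith)]
      · congr 1; ring
      · intro ω hω
        simp only [Set.mem_ofPred_eq] at hω ⊢
        linarith [hu.1]
    · have hset : {ω | (if U ω ≤ 1 - α then U ω + α else U ω + α - 1) ≤ u}
          = {ω | U ω ≤ u - α} ∪ {ω | 1 - α < U ω} := by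
        ext ω
        simp only [Set.mem_ofPred_eq, Set.mem_union]
        have := hU.2.1 ω
        rw [Set.mem_Icc] at this
        split_ifs with h1
        · constructor
          · intro h2; left; linarith
          · rintro (h2 | h2) <;> linarith
        · constructor
          · intro h2; right; linarith
          · intro h2; linarith
      rw [hset, measure_union _ (measurableSet_lt measurable_const hU.1),
        hU.2.2 _ ⟨by linarith, by linarith [hα.1, hu.2]⟩,
        hU.measure_gt ⟨by linarith [hα.2], by linarith [hα.1]⟩,
        ← ENNReal.ofReal_add (by linarith) (by linarith [hα.1])]
      · congr 1; ring
      · rw [Set.disjoint_left]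
        intro ω hω hω'
        simp only [Set.mem_ofPred_eq] at hω hω'
        linarith [hu.2]

lemma IsDistortion.aemeasurable {σ : ℝ → ℝ} (hσ : IsDistortion σ) :
    AEMeasurable (fun u => ENNReal.ofReal (σ u)) (volume.restrict (Set.Ioo (0 : ℝ) 1)) :=
  (aemeasurable_restrict_of_monotoneOn measurableSet_Ioo
    (hσ.mono.mono Set.Ioo_subset_Ico_self)).ennreal_ofReal

lemma IsDistortion.aemeasurable_comp {P : Measure Ω} [IsProbabilityMeasure P] {U : Ω → ℝ}
    {σ : ℝ → ℝ} (hσ : IsDistortion σ) (hU : IsUniformRV P U) :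
    AEMeasurable (fun ω => ENNReal.ofReal (σ (U ω))) P := by
  have h := hσ.aemeasurable
  rw [← hU.map_eq] at h
  exact h.comp_measurable hU.1

lemma IsDistortion.tail_zero {σ : ℝ → ℝ} (hσ : IsDistortion σ) : distortionTail σ 0 = 1 := by
  have hi : IntegrableOn σ (Set.Ioo (0 : ℝ) 1) := by
    by_contra h
    have := hσ.integral_one
    rw [integral_undef h] at this
    exact zero_ne_one this
  rw [distortionTail, ← ofReal_integral_eq_lintegral_ofReal hi, hσ.integral_one,
    ENNReal.ofReal_one]
  filter_upwards [ae_restrict_mem measurableSet_Ioo] with u hu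
  exact hσ.nonneg u ⟨hu.1.le, hu.2⟩

lemma IsDistortion.tail_ne_top {σ : ℝ → ℝ} (hσ : IsDistortion σ) {c : ℝ} (hc : 0 ≤ c) :
    distortionTail σ c ≠ ∞ := by
  refine ne_top_of_le_ne_top ENNReal.one_ne_top (hσ.tail_zero ▸ ?_)
  exact lintegral_mono_set (Set.Ioo_subset_Ioo_left hc)

lemma setLIntegral_distortion_gt {P : Measure Ω} [IsProbabilityMeasure P] {U : Ω → ℝ}
    {σ : ℝ → ℝ} (hσ : IsDistortion σ) (hU : IsUniformRV P U) {c : ℝ} (hc : 0 ≤ c) :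
    ∫⁻ ω in {ω | c < U ω}, ENNReal.ofReal (σ (U ω)) ∂P = distortionTail σ c := by
  have hA : MeasurableSet {ω | c < U ω} := measurableSet_lt measurable_const hU.1
  have h2 : Set.Ioi c ∩ Set.Ioo (0 : ℝ) 1 = Set.Ioo c 1 := by
    ext x
    simp only [Set.mem_inter_iff, Set.mem_Ioi, Set.mem_Ioo]
    exact ⟨fun h => ⟨h.1, h.2.2⟩, fun h => ⟨h.1, hc.trans_lt h.1, h.2⟩⟩
  rw [distortionTail, ← h2, ← Measure.restrict_restrict measurableSet_Ioi, ← hU.map_eq,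
    Measure.restrict_map hU.1 measurableSet_Ioi, lintegral_map' _ hU.1.aemeasurable]
  · rfl
  · have h := hσ.aemeasurable
    rw [← hU.map_eq] at h
    rw [← Measure.restrict_map hU.1 measurableSet_Ioi]
    exact h.restrict

/-- Among all uniform `W`, the integral of `σ(W)` over `{U > c}` is maximal for `W = U`. -/
lemma setLIntegral_distortion_le {P : Measure Ω} [IsProbabilityMeasure P] {U W : Ω → ℝ}
    {σ : ℝ → ℝ} (hσ : IsDistortion σ) (hU : IsUniformRV P U) (hW : IsUniformRV P W)
    {c : ℝ} (hc : c ∈ Set.Ico (0 : ℝ) 1) :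
    ∫⁻ ω in {ω | c < U ω}, ENNReal.ofReal (σ (W ω)) ∂P ≤ distortionTail σ c := by
  set A := {ω | c < U ω}
  set B := {ω | c < W ω}
  have hA : MeasurableSet A := measurableSet_lt measurable_const hU.1
  have hB : MeasurableSet B := measurableSet_lt measurable_const hW.1
  have hAB : P A = P B := by
    rw [hU.measure_gt ⟨hc.1, hc.2.le⟩, hW.measure_gt ⟨hc.1, hc.2.le⟩]
  have hdiff : P (A \ B) = P (B \ A) :=
    
    measure_sdiff_symm hA.nullMeasurableSet hB.nullMeasurableSet hAB (measure_ne_top _ _)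
  have h1 : ∫⁻ ω in A \ B, ENNReal.ofReal (σ (W ω)) ∂P
      ≤ ∫⁻ ω in A \ B, ENNReal.ofReal (σ c) ∂P := by
    refine setLIntegral_mono' (hA.diff hB) fun ω hω => ENNReal.ofReal_le_ofReal ?_
    have hle : W ω ≤ c := not_lt.1 hω.2
    exact hσ.mono ⟨(hW.2.1 ω).1, hle.trans_lt hc.2⟩ hc hle
  have h2 : ∫⁻ ω in B \ A, ENNReal.ofReal (σ c) ∂P
      ≤ ∫⁻ ω in B \ A, ENNReal.ofReal (σ (W ω)) ∂P := by
    refine lintegral_mono_ae ?_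
    filter_upwards [ae_restrict_mem (hB.diff hA), ae_restrict_of_ae hW.ae_mem_Ioo] with ω hω hI
    exact ENNReal.ofReal_le_ofReal (hσ.mono hc ⟨hI.1.le, hI.2⟩ (le_of_lt hω.1))
  rw [← setLIntegral_distortion_gt hσ hW hc.1, ← lintegral_inter_add_sdiff _ A hB,
    ← lintegral_inter_add_sdiff _ B hA, Set.inter_comm B A]
  refine add_le_add_right (h1.trans (le_trans ?_ h2)) _
  rw [setLIntegral_const, setLIntegral_const, hdiff]

lemma sigmaPow_eq_tail {P : Measure Ω} [IsProbabilityMeasure P] {U : Ω → ℝ}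
    {σ : ℝ → ℝ} (hσ : IsDistortion σ) (hU : IsUniformRV P U) {p : ℝ}
    {X : Type*} [NormedAddCommGroup X] {Y : Ω → X} {a b : ℝ} (ha : a ∈ Set.Ico (0 : ℝ) 1)
    (hb : b ∈ Set.Ico (0 : ℝ) 1) {K : ℝ≥0∞}
    (hY : ∀ ω, (‖Y ω‖₊ : ℝ≥0∞) ^ p
      = {ω | a < U ω}.indicator 1 ω + K * {ω | b < U ω}.indicator 1 ω) :
    sigmaPow P σ p Y = distortionTail σ a + K * distortionTail σ b := by
  have key : ∀ W, IsUniformRV P W →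
      ∫⁻ ω, ENNReal.ofReal (σ (W ω)) * (‖Y ω‖₊ : ℝ≥0∞) ^ p ∂P
        = ∫⁻ ω in {ω | a < U ω}, ENNReal.ofReal (σ (W ω)) ∂P
          + K * ∫⁻ ω in {ω | b < U ω}, ENNReal.ofReal (σ (W ω)) ∂P := by
    intro W hW
    have hm (c : ℝ) : MeasurableSet {ω | c < U ω} := measurableSet_lt measurable_const hU.1
    have hs := hσ.aemeasurable_comp hW
    rw [← lintegral_indicator (hm a), ← lintegral_indicator (hm b),
      ← lintegral_const_mul'' _ (hs.indicator (hm b)), ← lintegral_add_left' (hs.indicator (hm a))]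
    refine lintegral_congr fun ω => ?_
    rw [hY]
    by_cases h1 : a < U ω <;> by_cases h2 : b < U ω <;> simp [h1, h2, mul_add, mul_comm]
  unfold sigmaPow
  apply le_antisymm
  · refine iSup₂_le fun W hW => ?_
    rw [key W hW]
    gcongr
    · exact setLIntegral_distortion_le hσ hU hW ha
    · exact setLIntegral_distortion_le hσ hU hW hb
  · refine le_iSup₂_of_le U hU ?_
    rw [key U hU, setLIntegral_distortion_gt hσ hU ha.1, setLIntegral_distortion_gt hσ hU hb.1]

lemma sigmaNorm_sq (P : Measure Ω) (σ : ℝ → ℝ) (p : ℝ) {X : Type*} [NormedAddCommGroup X]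
    (Y : Ω → X) : sigmaNorm P σ p Y ^ 2 = sigmaPow P σ p Y ^ (2 / p) := by
  rw [sigmaNorm, ← ENNReal.rpow_natCast, ← ENNReal.rpow_mul]
  congr 1
  push_cast
  ring

lemma sigmaPow_const {P : Measure Ω} [IsProbabilityMeasure P]
    (hrich : ∃ U : Ω → ℝ, IsUniformRV P U) {σ : ℝ → ℝ} (hσ : IsDistortion σ) (p : ℝ)
    {X : Type*} [NormedAddCommGroup X] (x : X) :
    sigmaPow P σ p (fun _ : Ω => x) = (‖x‖₊ : ℝ≥0∞) ^ p := by
  have key : ∀ U, IsUniformRV P U →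
      ∫⁻ ω, ENNReal.ofReal (σ (U ω)) * (‖x‖₊ : ℝ≥0∞) ^ p ∂P = (‖x‖₊ : ℝ≥0∞) ^ p := by
    intro U hU
    have h1 : ∫⁻ ω, ENNReal.ofReal (σ (U ω)) ∂P = 1 := by
      rw [← hσ.tail_zero, ← setLIntegral_distortion_gt hσ hU le_rfl]
      rw [Measure.restrict_eq_self_of_ae_mem]
      filter_upwards [hU.ae_mem_Ioo] with ω hω using hω.1
    rw [lintegral_mul_const'' _ (hσ.aemeasurable_comp hU), h1, one_mul]
  obtain ⟨U, hU⟩ := hrich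
  exact le_antisymm (iSup₂_le fun W hW => (key W hW).le) (le_iSup₂_of_le U hU (key U hU).ge)

lemma sigmaPow_two_of_eq_one {P : Measure Ω} [IsProbabilityMeasure P]
    (hrich : ∃ U : Ω → ℝ, IsUniformRV P U) {σ : ℝ → ℝ} (hσ : ∀ u ∈ Set.Ioo (0 : ℝ) 1, σ u = 1)
    {X : Type*} [NormedAddCommGroup X] (Y : Ω → X) :
    sigmaPow P σ 2 Y = ∫⁻ ω, (‖Y ω‖₊ : ℝ≥0∞) ^ 2 ∂P := by
  have key : ∀ U, IsUniformRV P U →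
      ∫⁻ ω, ENNReal.ofReal (σ (U ω)) * (‖Y ω‖₊ : ℝ≥0∞) ^ (2 : ℝ) ∂P
        = ∫⁻ ω, (‖Y ω‖₊ : ℝ≥0∞) ^ 2 ∂P := by
    intro U hU
    refine lintegral_congr_ae ?_
    filter_upwards [hU.ae_mem_Ioo] with ω hω
    simp [hσ _ hω]
  obtain ⟨U, hU⟩ := hrich
  exact le_antisymm (iSup₂_le fun W hW => (key W hW).le) (le_iSup₂_of_le U hU (key U hU).ge)

lemma parallelogram_of_eq_one {P : Measure Ω} [IsProbabilityMeasure P]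
    (hrich : ∃ U : Ω → ℝ, IsUniformRV P U) {σ : ℝ → ℝ} (hσ : ∀ u ∈ Set.Ioo (0 : ℝ) 1, σ u = 1)
    {X : Type*} [NormedAddCommGroup X]
    (hX : ∀ x y : X, ‖x + y‖ ^ 2 + ‖x - y‖ ^ 2 = 2 * ‖x‖ ^ 2 + 2 * ‖y‖ ^ 2)
    {Y₁ Y₂ : Ω → X} (h₁ : AEStronglyMeasurable Y₁ P) (h₂ : AEStronglyMeasurable Y₂ P) :
    sigmaNorm P σ 2 (Y₁ + Y₂) ^ 2 + sigmaNorm P σ 2 (Y₁ - Y₂) ^ 2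
      = 2 * sigmaNorm P σ 2 Y₁ ^ 2 + 2 * sigmaNorm P σ 2 Y₂ ^ 2 := by
  have hm {Y : Ω → X} (h : AEStronglyMeasurable Y P) :
      AEMeasurable (fun ω => (‖Y ω‖₊ : ℝ≥0∞) ^ 2) P := h.enorm.pow_const 2
  simp only [sigmaNorm_sq, sigmaPow_two_of_eq_one hrich hσ]
  norm_num
  rw [← lintegral_add_left' (by simpa using hm (h₁.add h₂)), ← lintegral_const_mul'' _ (hm h₁),
    ← lintegral_const_mul'' _ (hm h₂), ← lintegral_add_left' ((hm h₁).const_mul 2)]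
  refine lintegral_congr fun ω => ?_
  have h : ‖Y₁ ω + Y₂ ω‖₊ ^ 2 + ‖Y₁ ω - Y₂ ω‖₊ ^ 2 = 2 * ‖Y₁ ω‖₊ ^ 2 + 2 * ‖Y₂ ω‖₊ ^ 2 :=
    NNReal.coe_injective (by push_cast; exact hX _ _)
  exact_mod_cast congrArg (fun r : ℝ≥0 => (r : ℝ≥0∞)) h

/-- An exponent comparison along the sequence `2⁻ⁿ` forces `p = 2`. -/
lemma eq_two_of_one_add_rpow_eq {p : ℝ} (hp : 1 ≤ p)
    (h : ∀ n : ℕ, 1 + (2 ^ p - 1) * ((1 / 2 : ℝ) ^ (n + 1)) ^ (p / 2)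
      = (1 + 3 * (1 / 2 : ℝ) ^ (n + 1)) ^ (p / 2)) : p = 2 := by
  set q : ℝ := (1 / 2 : ℝ) ^ (p / 2) with hq
  have hq0 : 0 < q := by positivity
  have hpow (n : ℕ) : ((1 / 2 : ℝ) ^ n) ^ (p / 2) = q ^ n := by
    rw [hq, ← Real.rpow_natCast, ← Real.rpow_natCast, ← Real.rpow_mul (by norm_num),
      ← Real.rpow_mul (by norm_num), mul_comm]
  have hone (n : ℕ) : (1 : ℝ) ≤ 1 + 3 * (1 / 2 : ℝ) ^ n := by
    have : (0 : ℝ) < (1 / 2) ^ n := by positivity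
    linarith
  have h2p : (2 : ℝ) ≤ 2 ^ p := by
    simpa using Real.rpow_le_rpow_of_exponent_le one_le_two hp
  have hunb (r C : ℝ) (hr : 1 < r) (hC : ∀ n : ℕ, r ^ (n + 1) ≤ C) : False := by
    obtain ⟨n, hn⟩ := pow_unbounded_of_one_lt C hr
    exact absurd (hC n) (not_le.2 (hn.trans_le (pow_le_pow_right₀ hr.le n.le_succ)))
  rcases lt_trichotomy p 2 with h2 | h2 | h2
  · exfalso
    have hq2 : 1 / 2 < q := by
      simpa [hq] using Real.rpow_lt_rpow_of_exponent_gt (x := (1 / 2 : ℝ)) (by norm_num) (by norm_num)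
        (show p / 2 < 1 by linarith)
    refine hunb (q * 2) 3 (by linarith) fun n => ?_
    have h3 := h n
    rw [hpow] at h3
    have h4 := Real.rpow_le_rpow_of_exponent_le (hone (n + 1)) (show p / 2 ≤ 1 by linarith)
    rw [Real.rpow_one] at h4
    have h5 : q ^ (n + 1) ≤ 3 * (1 / 2) ^ (n + 1) := by
      nlinarith [pow_pos hq0 (n + 1)]
    calc (q * 2) ^ (n + 1) = q ^ (n + 1) * 2 ^ (n + 1) := mul_pow _ _ _
      _ ≤ 3 * (1 / 2) ^ (n + 1) * 2 ^ (n + 1) := by gcongr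
      _ = 3 := by rw [mul_assoc, ← mul_pow]; norm_num
  · exact h2
  · exfalso
    have hq2 : q < 1 / 2 := by
      simpa [hq] using Real.rpow_lt_rpow_of_exponent_gt (x := (1 / 2 : ℝ)) (by norm_num) (by norm_num)
        (show 1 < p / 2 by linarith)
    refine hunb (1 / 2 / q) (2 ^ p) ((one_lt_div hq0).2 hq2) fun n => ?_
    have h3 := h n
    rw [hpow] at h3
    have h4 := Real.rpow_le_rpow_of_exponent_le (hone (n + 1)) (show 1 ≤ p / 2 by linarith)
    rw [Real.rpow_one] at h4
    have hpos : (0 : ℝ) < (1 / 2) ^ (n + 1) := by positivity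
    rw [div_pow, div_le_iff₀ (pow_pos hq0 _)]
    nlinarith [pow_pos hq0 (n + 1)]

section Forward

variable {P : Measure Ω} [IsProbabilityMeasure P] {U : Ω → ℝ} {σ : ℝ → ℝ} {p : ℝ}
  {X : Type*} [NormedAddCommGroup X]

lemma sigmaPow_eq_tail_of_nnnorm_eq_one (hσ : IsDistortion σ) (hU : IsUniformRV P U) (hp : 0 < p)
    {x : X} (hx : ‖x‖₊ = 1) {c : ℝ} (hc : c ∈ Set.Ico (0 : ℝ) 1) {Y : Ω → X}
    (hY : ∀ ω, ‖Y ω‖₊ = ‖{ω | c < U ω}.indicator (fun _ => x) ω‖₊) :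
    sigmaPow P σ p Y = distortionTail σ c := by
  rw [sigmaPow_eq_tail hσ hU hc hc (K := 0), zero_mul, add_zero]
  intro ω
  rw [hY]
  by_cases h : c < U ω <;> simp [h, hx, hp]

omit [IsProbabilityMeasure P] in
lemma aestronglyMeasurable_indicator_Ioc (hU : IsUniformRV P U) (a b : ℝ) (x : X) :
    AEStronglyMeasurable ({ω | a < U ω ∧ U ω ≤ b}.indicator fun _ => x) P :=
  aestronglyMeasurable_const.indicator
    ((measurableSet_lt measurable_const hU.1).inter (measurableSet_le hU.1 measurable_const))

lemma tail_additive (hσ : IsDistortion σ) (hU : IsUniformRV P U) (hp : 0 < p)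
    {x : X} (hx : ‖x‖₊ = 1)
    (hpar : ∀ Y₁ Y₂ : Ω → X, MemLsigma P σ p Y₁ → MemLsigma P σ p Y₂ →
        sigmaNorm P σ p (Y₁ + Y₂) ^ 2 + sigmaNorm P σ p (Y₁ - Y₂) ^ 2
          = 2 * sigmaNorm P σ p Y₁ ^ 2 + 2 * sigmaNorm P σ p Y₂ ^ 2)
    {α β : ℝ} (hα : 0 < α) (hβ : 0 < β) (hαβ : α + β ≤ 1) :
    distortionTail σ (1 - (α + β)) ^ (2 / p)
      = distortionTail σ (1 - α) ^ (2 / p) + distortionTail σ (1 - β) ^ (2 / p) := by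
  set V : Ω → ℝ := fun ω => if U ω ≤ 1 - α then U ω + α else U ω + α - 1 with hVdef
  have hV : IsUniformRV P V := hU.rotate ⟨hα.le, by linarith⟩
  have hVβ (ω : Ω) : 1 - β < V ω ↔ (1 - (α + β) < U ω ∧ U ω ≤ 1 - α) := by
    have := (hU.2.1 ω).2
    simp only [hVdef]
    split_ifs with h
    · exact ⟨fun h' => ⟨by linarith, h⟩, fun h' => by linarith [h'.1]⟩
    · exact ⟨fun h' => by linarith, fun h' => absurd h'.2 h⟩
  set Y₁ : Ω → X := {ω | 1 - α < U ω ∧ U ω ≤ 1}.indicator fun _ => x with hY₁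
  set Y₂ : Ω → X := {ω | 1 - (α + β) < U ω ∧ U ω ≤ 1 - α}.indicator fun _ => x with hY₂
  have e₁ : sigmaPow P σ p Y₁ = distortionTail σ (1 - α) := by
    refine sigmaPow_eq_tail_of_nnnorm_eq_one hσ hU hp hx ⟨by linarith, by linarith⟩ fun ω => ?_
    have := (hU.2.1 ω).2
    simp [hY₁, Set.indicator_apply, this]
  have e₂ : sigmaPow P σ p Y₂ = distortionTail σ (1 - β) := by
    refine sigmaPow_eq_tail_of_nnnorm_eq_one hσ hV hp hx ⟨by linarith, by linarith⟩ fun ω => ?_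
    simp only [hY₂, Set.indicator_apply, Set.mem_ofPred_eq, hVβ]
  have e₃ : sigmaPow P σ p (Y₁ + Y₂) = distortionTail σ (1 - (α + β)) := by
    refine sigmaPow_eq_tail_of_nnnorm_eq_one hσ hU hp hx ⟨by linarith, by linarith⟩ fun ω => ?_
    have h1 := (hU.2.1 ω).2
    simp only [hY₁, hY₂, Pi.add_apply, Set.indicator_apply, Set.mem_ofPred_eq, h1, and_true]
    by_cases h2 : 1 - α < U ω
    · have h3 : 1 - (α + β) < U ω := by linarith
      simp [h2, h3, h2.not_ge]
    · simp [h2, not_lt.1 h2]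
  have e₄ : sigmaPow P σ p (Y₁ - Y₂) = distortionTail σ (1 - (α + β)) := by
    refine sigmaPow_eq_tail_of_nnnorm_eq_one hσ hU hp hx ⟨by linarith, by linarith⟩ fun ω => ?_
    have h1 := (hU.2.1 ω).2
    simp only [hY₁, hY₂, Pi.sub_apply, Set.indicator_apply, Set.mem_ofPred_eq, h1, and_true]
    by_cases h2 : 1 - α < U ω
    · have h3 : 1 - (α + β) < U ω := by linarith
      simp [h2, h3, h2.not_ge]
    · by_cases h3 : 1 - (α + β) < U ω <;> simp [h2, h3, not_lt.1 h2]
  have h := hpar Y₁ Y₂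
    ⟨aestronglyMeasurable_indicator_Ioc hU _ _ _, e₁ ▸ (hσ.tail_ne_top (by linarith)).lt_top⟩
    ⟨aestronglyMeasurable_indicator_Ioc hU _ _ _, e₂ ▸ (hσ.tail_ne_top (by linarith)).lt_top⟩
  simp only [sigmaNorm_sq, e₁, e₂, e₃, e₄] at h
  rw [← two_mul, ← mul_add] at h
  exact (ENNReal.mul_right_inj two_ne_zero ENNReal.ofNat_ne_top).1 h

lemma tail_parallelogram_one_add (hσ : IsDistortion σ) (hU : IsUniformRV P U) (hp : 0 < p)
    [NormedSpace ℝ X] {x : X} (hx : ‖x‖₊ = 1)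
    (hpar : ∀ Y₁ Y₂ : Ω → X, MemLsigma P σ p Y₁ → MemLsigma P σ p Y₂ →
        sigmaNorm P σ p (Y₁ + Y₂) ^ 2 + sigmaNorm P σ p (Y₁ - Y₂) ^ 2
          = 2 * sigmaNorm P σ p Y₁ ^ 2 + 2 * sigmaNorm P σ p Y₂ ^ 2)
    {α : ℝ} (hα : 0 < α) (hα1 : α < 1) :
    (1 + ENNReal.ofReal (2 ^ p - 1) * distortionTail σ (1 - α)) ^ (2 / p)
        + distortionTail σ α ^ (2 / p)
      = 2 + 2 * distortionTail σ (1 - α) ^ (2 / p) := by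
  set V : Ω → ℝ := fun ω => if U ω ≤ 1 - α then U ω + α else U ω + α - 1 with hVdef
  have hV : IsUniformRV P V := hU.rotate ⟨hα.le, hα1.le⟩
  have hVα (ω : Ω) : α < V ω ↔ (0 < U ω ∧ U ω ≤ 1 - α) := by
    have := (hU.2.1 ω).2
    simp only [hVdef]
    split_ifs with h
    · exact ⟨fun h' => ⟨by linarith, h⟩, fun h' => by linarith [h'.1]⟩
    · exact ⟨fun h' => by linarith, fun h' => absurd h'.2 h⟩
  set Y₁ : Ω → X := {ω | 0 < U ω ∧ U ω ≤ 1}.indicator fun _ => x with hY₁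
  set Y₂ : Ω → X := {ω | 1 - α < U ω ∧ U ω ≤ 1}.indicator fun _ => x with hY₂
  have e₁ : sigmaPow P σ p Y₁ = 1 := by
    rw [← hσ.tail_zero]
    refine sigmaPow_eq_tail_of_nnnorm_eq_one hσ hU hp hx ⟨by linarith, by linarith⟩ fun ω => ?_
    have := (hU.2.1 ω).2
    simp [hY₁, Set.indicator_apply, this]
  have e₂ : sigmaPow P σ p Y₂ = distortionTail σ (1 - α) := by
    refine sigmaPow_eq_tail_of_nnnorm_eq_one hσ hU hp hx ⟨by linarith, by linarith⟩ fun ω => ?_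
    have := (hU.2.1 ω).2
    simp [hY₂, Set.indicator_apply, this]
  have e₃ : sigmaPow P σ p (Y₁ + Y₂)
      = 1 + ENNReal.ofReal (2 ^ p - 1) * distortionTail σ (1 - α) := by
    rw [← hσ.tail_zero]
    refine sigmaPow_eq_tail hσ hU ⟨by linarith, by linarith⟩ ⟨by linarith, by linarith⟩ fun ω => ?_
    have h1 := (hU.2.1 ω).2
    simp only [hY₁, hY₂, Pi.add_apply, Set.indicator_apply, Set.mem_ofPred_eq, h1, and_true]
    by_cases h2 : 1 - α < U ω
    · have h3 : 0 < U ω := by linarith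
      have h4 : ‖x + x‖₊ = 2 := by
        rw [← two_smul ℝ x, nnnorm_smul, hx]
        simp
      have h5 : (1 : ℝ) ≤ 2 ^ p := Real.one_le_rpow one_le_two hp.le
      simp only [h2, h3, if_true, h4, Pi.one_apply, mul_one]
      rw [← ENNReal.ofReal_one, ← ENNReal.ofReal_add zero_le_one (by linarith),
        add_sub_cancel, ← ENNReal.ofReal_rpow_of_pos two_pos]
      simp
    · by_cases h3 : 0 < U ω <;> simp [h2, h3, hx, hp]
  have e₄ : sigmaPow P σ p (Y₁ - Y₂) = distortionTail σ α := by
    refine sigmaPow_eq_tail_of_nnnorm_eq_one hσ hV hp hx ⟨by linarith, by linarith⟩ fun ω => ?_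
    have h1 := (hU.2.1 ω).2
    simp only [hY₁, hY₂, Pi.sub_apply, Set.indicator_apply, Set.mem_ofPred_eq, h1, and_true, hVα]
    by_cases h2 : 1 - α < U ω
    · have h3 : 0 < U ω := by linarith
      simp [h2, h3, h2.not_ge]
    · by_cases h3 : 0 < U ω <;> simp [h2, h3, not_lt.1 h2]
  have h := hpar Y₁ Y₂
    ⟨aestronglyMeasurable_indicator_Ioc hU _ _ _, e₁ ▸ ENNReal.one_lt_top⟩
    ⟨aestronglyMeasurable_indicator_Ioc hU _ _ _, e₂ ▸ (hσ.tail_ne_top (by linarith)).lt_top⟩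
  simpa only [sigmaNorm_sq, e₁, e₂, e₃, e₄, ENNReal.one_rpow, mul_one] using h

lemma eq_two_of_tail_identities (hσ : IsDistortion σ) (hp : 1 ≤ p)
    (hadd : ∀ α β : ℝ, 0 < α → 0 < β → α + β ≤ 1 →
      distortionTail σ (1 - (α + β)) ^ (2 / p)
        = distortionTail σ (1 - α) ^ (2 / p) + distortionTail σ (1 - β) ^ (2 / p))
    (hone : ∀ α : ℝ, 0 < α → α < 1 →
      (1 + ENNReal.ofReal (2 ^ p - 1) * distortionTail σ (1 - α)) ^ (2 / p)
          + distortionTail σ α ^ (2 / p)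
        = 2 + 2 * distortionTail σ (1 - α) ^ (2 / p)) : p = 2 := by
  have hp0 : 0 < p := by linarith
  have h2p : (1 : ℝ) ≤ 2 ^ p := Real.one_le_rpow one_le_two hp0.le
  have hfin {c : ℝ} (hc : 0 ≤ c) : distortionTail σ c ^ (2 / p) ≠ ∞ :=
    ENNReal.rpow_ne_top_of_nonneg (by positivity) (hσ.tail_ne_top hc)
  set d : ℝ → ℝ := fun α => (distortionTail σ (1 - α)).toReal ^ (2 / p) with hd
  have hdadd (α β : ℝ) (hα : 0 < α) (hβ : 0 < β) (h : α + β ≤ 1) : d (α + β) = d α + d β := by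
    have := congrArg ENNReal.toReal (hadd α β hα hβ h)
    rwa [ENNReal.toReal_add (hfin (by linarith)) (hfin (by linarith)), ← ENNReal.toReal_rpow,
      ← ENNReal.toReal_rpow, ← ENNReal.toReal_rpow] at this
  have hd1 : d 1 = 1 := by simp [hd, hσ.tail_zero]
  have hdpow (n : ℕ) : d ((1 / 2) ^ n) = (1 / 2) ^ n := by
    induction n with
    | zero => simpa using hd1
    | succ n ih =>
      have hpos : (0 : ℝ) < (1 / 2) ^ (n + 1) := by positivity
      have h2 : (1 / 2 : ℝ) ^ (n + 1) + (1 / 2) ^ (n + 1) = (1 / 2) ^ n := by ring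
      have h := hdadd _ _ hpos hpos (h2 ▸ pow_le_one₀ (by norm_num) (by norm_num))
      rw [h2, ih] at h
      linarith
  refine eq_two_of_one_add_rpow_eq hp fun n => ?_
  set h : ℝ := (1 / 2) ^ (n + 1)
  have hpos : 0 < h := by positivity
  have hlt : h < 1 := pow_lt_one₀ (by norm_num) (by norm_num) n.succ_ne_zero
  have hdh : d h = h := hdpow (n + 1)
  have hdc : d (1 - h) = 1 - h := by
    have := hdadd (1 - h) h (by linarith) hpos (by linarith)
    rw [sub_add_cancel, hd1, hdh] at this
    linarith
  have e1 : (distortionTail σ (1 - h)).toReal ^ (2 / p) = h := hdh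
  have hT : (distortionTail σ (1 - h)).toReal = h ^ (p / 2) := by
    conv_rhs => rw [← e1]
    rw [← Real.rpow_mul ENNReal.toReal_nonneg, show 2 / p * (p / 2) = 1 by field_simp,
      Real.rpow_one]
  have hTfin : distortionTail σ (1 - h) ≠ ∞ := hσ.tail_ne_top (by linarith)
  have key := congrArg ENNReal.toReal (hone h hpos hlt)
  have hmul : ENNReal.ofReal (2 ^ p - 1) * distortionTail σ (1 - h) ≠ ∞ :=
    ENNReal.mul_ne_top ENNReal.ofReal_ne_top hTfin
  rw [ENNReal.toReal_add (ENNReal.rpow_ne_top_of_nonneg (by positivity)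
      (ENNReal.add_ne_top.2 ⟨ENNReal.one_ne_top, hmul⟩)) (hfin hpos.le),
    ENNReal.toReal_add ENNReal.ofNat_ne_top
      (ENNReal.mul_ne_top ENNReal.ofNat_ne_top (hfin (by linarith))), ENNReal.toReal_mul,
    ← ENNReal.toReal_rpow, ← ENNReal.toReal_rpow, ← ENNReal.toReal_rpow,
    ENNReal.toReal_add ENNReal.one_ne_top hmul, ENNReal.toReal_mul,
    ENNReal.toReal_ofReal (by linarith)] at key
  simp only [ENNReal.toReal_one, ENNReal.toReal_ofNat] at key
  have e2 : (distortionTail σ h).toReal ^ (2 / p) = 1 - h := by simpa [hd] using hdc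
  rw [e1, e2, hT] at key
  have h0 : 0 ≤ 1 + (2 ^ p - 1) * h ^ (p / 2) := by
    have : 0 ≤ (2 ^ p - 1) * h ^ (p / 2) := mul_nonneg (by linarith) (by positivity)
    linarith
  rw [show 1 + 3 * h = (1 + (2 ^ p - 1) * h ^ (p / 2)) ^ (2 / p) by linarith,
    ← Real.rpow_mul h0, show 2 / p * (p / 2) = 1 by field_simp, Real.rpow_one]

lemma parallelogram_of_sigmaNorm (hσ : IsDistortion σ) (hU : IsUniformRV P U) (hp : 0 < p)
    (hpar : ∀ Y₁ Y₂ : Ω → X, MemLsigma P σ p Y₁ → MemLsigma P σ p Y₂ →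
        sigmaNorm P σ p (Y₁ + Y₂) ^ 2 + sigmaNorm P σ p (Y₁ - Y₂) ^ 2
          = 2 * sigmaNorm P σ p Y₁ ^ 2 + 2 * sigmaNorm P σ p Y₂ ^ 2) (x y : X) :
    ‖x + y‖ ^ 2 + ‖x - y‖ ^ 2 = 2 * ‖x‖ ^ 2 + 2 * ‖y‖ ^ 2 := by
  have hpow (z : X) : sigmaPow P σ p (fun _ : Ω => z) = (‖z‖₊ : ℝ≥0∞) ^ p :=
    sigmaPow_const ⟨U, hU⟩ hσ p z
  have hmem (z : X) : MemLsigma P σ p (fun _ : Ω => z) :=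
    ⟨aestronglyMeasurable_const, by
      rw [hpow]
      exact ENNReal.rpow_lt_top_of_nonneg hp.le ENNReal.coe_ne_top⟩
  have hnorm (z : X) : sigmaNorm P σ p (fun _ : Ω => z) = ‖z‖₊ := by
    rw [sigmaNorm, hpow, ← ENNReal.rpow_mul, mul_one_div_cancel hp.ne', ENNReal.rpow_one]
  have h := hpar _ _ (hmem x) (hmem y)
  change sigmaNorm P σ p (fun _ => x + y) ^ 2 + sigmaNorm P σ p (fun _ => x - y) ^ 2 = _ at h
  simp only [hnorm] at h
  have h' : ‖x + y‖₊ ^ 2 + ‖x - y‖₊ ^ 2 = 2 * ‖x‖₊ ^ 2 + 2 * ‖y‖₊ ^ 2 := by exact_mod_cast h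
  simpa using congrArg NNReal.toReal h'

end Forward

/-- If the tails of a distortion function are additive, it is constantly one. -/
lemma IsDistortion.eq_one_of_tail_additive {σ : ℝ → ℝ} (hσ : IsDistortion σ)
    (hadd : ∀ α β : ℝ, 0 < α → 0 < β → α + β ≤ 1 →
      distortionTail σ (1 - (α + β)) = distortionTail σ (1 - α) + distortionTail σ (1 - β)) :
    ∀ u ∈ Set.Ioo (0 : ℝ) 1, σ u = 1 := by
  have hsplit {a b : ℝ} (ha : 0 ≤ a) (hab : a < b) (hb : b < 1) :
      distortionTail σ a
        = (∫⁻ u in Set.Ioc a b, ENNReal.ofReal (σ u)) + distortionTail σ b := by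
    rw [distortionTail, distortionTail, ← Set.Ioc_union_Ioo_eq_Ioo hab.le hb,
      lintegral_union measurableSet_Ioo]
    exact Set.disjoint_left.2 fun x hx hx' => hx.2.not_gt hx'.1
  have hle {u w : ℝ} (hu : 0 < u) (huw : u < w) (hw : w < 1) : σ w ≤ σ u := by
    obtain ⟨ε, hε0, hεu, hεw⟩ : ∃ ε > 0, ε ≤ u ∧ w + ε < 1 :=
      ⟨min u ((1 - w) / 2), lt_min hu (by linarith), min_le_left _ _, by
        linarith [min_le_right u ((1 - w) / 2)]⟩
    have h1 := hadd (1 - u) ε (by linarith) hε0 (by linarith)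
    have h2 := hadd (1 - (w + ε)) ε (by linarith) hε0 (by linarith)
    rw [show 1 - (1 - u + ε) = u - ε by ring, sub_sub_cancel,
      hsplit (by linarith) (by linarith) (huw.trans hw), add_comm] at h1
    rw [show 1 - (1 - (w + ε) + ε) = w by ring, sub_sub_cancel,
      hsplit (by linarith) (show w < w + ε by linarith) hεw, add_comm] at h2
    have h1' := (ENNReal.add_right_inj (hσ.tail_ne_top hu.le)).1 h1
    have h2' := (ENNReal.add_right_inj (hσ.tail_ne_top (by linarith))).1 h2
    have h3 : ∫⁻ v in Set.Ioc (u - ε) u, ENNReal.ofReal (σ v)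
        ≤ ENNReal.ofReal (σ u) * ENNReal.ofReal ε := by
      calc _ ≤ ∫⁻ v in Set.Ioc (u - ε) u, ENNReal.ofReal (σ u) := by
            refine setLIntegral_mono' measurableSet_Ioc fun v hv => ENNReal.ofReal_le_ofReal ?_
            exact hσ.mono ⟨by linarith [hv.1], by linarith [hv.2]⟩ ⟨hu.le, by linarith⟩ hv.2
        _ = _ := by rw [setLIntegral_const, Real.volume_Ioc, sub_sub_cancel]
    have h4 : ENNReal.ofReal (σ w) * ENNReal.ofReal ε
        ≤ ∫⁻ v in Set.Ioc w (w + ε), ENNReal.ofReal (σ v) := by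
      calc _ = ∫⁻ v in Set.Ioc w (w + ε), ENNReal.ofReal (σ w) := by
            rw [setLIntegral_const, Real.volume_Ioc, add_sub_cancel_left]
        _ ≤ _ := by
            refine setLIntegral_mono' measurableSet_Ioc fun v hv => ENNReal.ofReal_le_ofReal ?_
            exact hσ.mono ⟨by linarith, hw⟩ ⟨by linarith [hv.1], by linarith [hv.2]⟩ hv.1.le
    rw [h2', ← h1'] at h4
    have h5 := h4.trans h3
    rw [ENNReal.mul_le_mul_iff_left (by simpa using hε0) ENNReal.ofReal_ne_top] at h5
    exact (ENNReal.ofReal_le_ofReal_iff (hσ.nonneg u ⟨hu.le, by linarith⟩)).1 h5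
  have heq {u w : ℝ} (hu : u ∈ Set.Ioo (0 : ℝ) 1) (hw : w ∈ Set.Ioo (0 : ℝ) 1) (huw : u < w) :
      σ u = σ w :=
    le_antisymm (hσ.mono ⟨hu.1.le, hu.2⟩ ⟨hw.1.le, hw.2⟩ huw.le) (hle hu.1 huw hw.2)
  intro u hu
  have h := hσ.integral_one
  rw [setIntegral_congr_fun (g := fun _ => σ u) measurableSet_Ioo] at h
  · simpa using h
  · intro v hv
    rcases lt_trichotomy v u with h | h | h
    · exact heq hv hu h
    · exact congrArg σ h
    · exact (heq hu hv h).symm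

/-- For `X ≠ {0}` the following are equivalent:
(1) `L_σ^p(P,X)` with `‖·‖_{σ,p}` is a Hilbert space (the norm satisfies the
parallelogram law); (2) `X` is a Hilbert space (its norm satisfies the parallelogram
law), `p = 2` and `σ = 1` on `(0,1)`. -/
theorem statement8
    (P : Measure Ω) [IsProbabilityMeasure P]
    (hrich : ∃ U : Ω → ℝ, IsUniformRV P U)
    (hsets : ∀ α ∈ Set.Icc (0 : ℝ) 1, ∃ E : Set Ω, MeasurableSet E ∧ P E = ENNReal.ofReal α)
    {X : Type*} [NormedAddCommGroup X] [NormedSpace ℝ X] [Nontrivial X]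
    (σ : ℝ → ℝ) (hσ : IsDistortion σ) (p : ℝ) (hp : 1 ≤ p) :
    (∀ Y₁ Y₂ : Ω → X, MemLsigma P σ p Y₁ → MemLsigma P σ p Y₂ →
        sigmaNorm P σ p (Y₁ + Y₂) ^ 2 + sigmaNorm P σ p (Y₁ - Y₂) ^ 2
          = 2 * sigmaNorm P σ p Y₁ ^ 2 + 2 * sigmaNorm P σ p Y₂ ^ 2)
      ↔ ((∀ x y : X, ‖x + y‖ ^ 2 + ‖x - y‖ ^ 2 = 2 * ‖x‖ ^ 2 + 2 * ‖y‖ ^ 2) ∧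
          p = 2 ∧ ∀ u ∈ Set.Ioo (0 : ℝ) 1, σ u = 1) := by
  constructor
  · intro hpar
    obtain ⟨U, hU⟩ := hrich
    obtain ⟨x, hx⟩ := exists_norm_eq X (zero_le_one : (0 : ℝ) ≤ 1)
    have hx' : ‖x‖₊ = 1 := NNReal.eq hx
    have hp0 : 0 < p := by linarith
    have hadd (α β : ℝ) (hα : 0 < α) (hβ : 0 < β) (h : α + β ≤ 1) :=
      tail_additive hσ hU hp0 hx' hpar hα hβ h
    have hp2 : p = 2 := eq_two_of_tail_identities hσ hp hadd fun α hα hα1 =>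
      tail_parallelogram_one_add hσ hU hp0 hx' hpar hα hα1
    refine ⟨parallelogram_of_sigmaNorm hσ hU hp0 hpar, hp2,
      hσ.eq_one_of_tail_additive fun α β hα hβ h => ?_⟩
    simpa [hp2] using hadd α β hα hβ h
  · rintro ⟨hX, rfl, hσ1⟩ Y₁ Y₂ h₁ h₂
    exact parallelogram_of_eq_one hrich hσ1 hX h₁.1 h₂.1

end
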